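/- arXiv:2101.02621 — 5 statements merged into one kernel-verified Lean document; each statement's English description precedes it below -/
import Mathlib

section
/- Let G be a perfect group, i.e. the commutator subgroup of G equals all of G, and let ρ : G →* SU(2) be a group homomorphism. Then ρ is the trivial homomorphism (ρ g = 1 for all g ∈ G) if and only if ρ is reducible, meaning there exists a nonzero vector v : Fin 2 → ℂ such that for every g ∈ G there is a scalar c : ℂ with (ρ g).val.mulVec v = c • v. In particular, for a perfect group a homomorphism to SU(2) is non-trivial if and only if it is irreducible. -/
theorem su2_fix_aux (U : Matrix (Fin 2) (Fin 2) ℂ)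
    (hU : U ∈ Matrix.specialUnitaryGroup (Fin 2) ℂ) (v : Fin 2 → ℂ) (hv : v ≠ 0)
    (h : U.mulVec v = v) : U = 1 := by
  rw [Matrix.mem_specialUnitaryGroup_iff] at hU
  obtain ⟨h1, hdet⟩ := hU
  have hs := Matrix.mem_unitaryGroup_iff'.1 h1
  have hd : (U - 1).det = 0 :=
    Matrix.exists_mulVec_eq_zero_iff.1 ⟨v, hv, by rw [Matrix.sub_mulVec, h, Matrix.one_mulVec, sub_self]⟩
  rw [Matrix.det_fin_two] at hd hdet
  simp only [Matrix.sub_apply, Matrix.one_apply] at hd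
  norm_num at hd
  have htr : U 0 0 + U 1 1 = 2 := by linear_combination hdet - hd
  have e0 := congrArg Complex.re (congrFun (congrFun hs 0) 0)
  have e1 := congrArg Complex.re (congrFun (congrFun hs 1) 1)
  have htr' := congrArg Complex.re htr
  simp [Matrix.mul_apply, Fin.sum_univ_two, Matrix.star_apply] at e0 e1 htr'
  have a1 : (U 0 0).re ≤ 1 := by nlinarith [sq_nonneg (U 0 0).im, sq_nonneg (U 1 0).re, sq_nonneg (U 1 0).im]
  have d1 : (U 1 1).re ≤ 1 := by nlinarith [sq_nonneg (U 1 1).im, sq_nonneg (U 0 1).re, sq_nonneg (U 0 1).im]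
  have a : (U 0 0).re = 1 := by linarith
  have d : (U 1 1).re = 1 := by linarith
  rw [a] at e0
  rw [d] at e1
  have i1 : (U 0 0).im = 0 := by apply pow_eq_zero_iff (two_ne_zero) |>.1; nlinarith [sq_nonneg (U 0 0).im, sq_nonneg (U 1 0).re, sq_nonneg (U 1 0).im]
  have i2 : (U 1 0).re = 0 := by apply pow_eq_zero_iff (two_ne_zero) |>.1; nlinarith [sq_nonneg (U 0 0).im, sq_nonneg (U 1 0).re, sq_nonneg (U 1 0).im]
  have i3 : (U 1 0).im = 0 := by apply pow_eq_zero_iff (two_ne_zero) |>.1; nlinarith [sq_nonneg (U 0 0).im, sq_nonneg (U 1 0).re, sq_nonneg (U 1 0).im]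
  have j1 : (U 1 1).im = 0 := by apply pow_eq_zero_iff (two_ne_zero) |>.1; nlinarith [sq_nonneg (U 1 1).im, sq_nonneg (U 0 1).re, sq_nonneg (U 0 1).im]
  have j2 : (U 0 1).re = 0 := by apply pow_eq_zero_iff (two_ne_zero) |>.1; nlinarith [sq_nonneg (U 1 1).im, sq_nonneg (U 0 1).re, sq_nonneg (U 0 1).im]
  have j3 : (U 0 1).im = 0 := by apply pow_eq_zero_iff (two_ne_zero) |>.1; nlinarith [sq_nonneg (U 1 1).im, sq_nonneg (U 0 1).re, sq_nonneg (U 0 1).im]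
  ext i j
  fin_cases i <;> fin_cases j <;> apply Complex.ext <;> simp [*]

/-- For a perfect group, a homomorphism to `SU(2)` is trivial if and only if it is
reducible (i.e. admits a common eigenvector). -/
theorem perfect_group_su2_trivial_iff_reducible
    (G : Type*) [Group G] (hG : commutator G = ⊤)
    (ρ : G →* Matrix.specialUnitaryGroup (Fin 2) ℂ) :
    (∀ g : G, ρ g = 1) ↔
      ∃ v : Fin 2 → ℂ, v ≠ 0 ∧
        ∀ g : G, ∃ c : ℂ, (ρ g).val.mulVec v = c • v := by
  constructor
  · intro h
    refine ⟨fun _ => 1, fun h0 => one_ne_zero (congrFun h0 0), fun g => ⟨1, ?_⟩⟩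
    rw [h g]
    simp
  · rintro ⟨v, hv, h⟩
    choose c hc using h
    let χ : G →* ℂ :=
      { toFun := c
        map_one' := by
          apply smul_left_injective ℂ hv
          have := hc 1
          simp only [map_one, OneMemClass.coe_one, Matrix.one_mulVec] at this
          simp [← this]
        map_mul' := fun x y => by
          apply smul_left_injective ℂ hv
          have := hc (x * y)
          rw [map_mul, Submonoid.coe_mul, ← Matrix.mulVec_mulVec, hc y, Matrix.mulVec_smul, hc x,
            smul_smul] at this
          simp only [← this, mul_comm] }
    intro g
    have hg : g ∈ χ.toHomUnits.ker :=
      Abelianization.commutator_subset_ker χ.toHomUnits (by rw [hG]; trivial)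
    have hcg : c g = 1 := congrArg Units.val (MonoidHom.mem_ker.1 hg)
    apply Subtype.ext
    apply su2_fix_aux _ (ρ g).2 v hv
    rw [hc g, hcg, one_smul]
end

section
/- Let A and B be elements of SU(2) and suppose there is a nonzero vector v : Fin 2 → ℂ which is a common eigenvector: there exist scalars a, b : ℂ with A.val.mulVec v = a • v and B.val.mulVec v = b • v. Then A and B commute: A * B = B * A. -/
open Matrix in
theorem su2_aux (A : Matrix.specialUnitaryGroup (Fin 2) ℂ)
    (v : Fin 2 → ℂ) (a : ℂ) (hA : A.val.mulVec v = a • v) :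
    A.val * !![v 0, -star (v 1); v 1, star (v 0)] =
      !![v 0, -star (v 1); v 1, star (v 0)] * Matrix.diagonal ![a, star a] := by
  obtain ⟨M, hM⟩ := A
  obtain ⟨hU, hd⟩ := Matrix.mem_specialUnitaryGroup_iff.1 hM
  have h1 : star M * M = 1 := Matrix.mem_unitaryGroup_iff'.1 hU
  have hadj : star M = M.adjugate := by
    have h2 : M * M.adjugate = 1 := by rw [Matrix.mul_adjugate, hd, one_smul]
    exact left_inv_eq_right_inv h1 h2
  have e00 := congrFun (congrFun hadj 0) 0
  have e10 := congrFun (congrFun hadj 0) 1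
  simp [Matrix.adjugate_fin_two, Matrix.star_apply] at e00 e10
  have e01 : (starRingEnd ℂ) (M 0 1) = - M 1 0 := by
    have := congrArg (starRingEnd ℂ) e10
    simp at this
    rw [this]; simp
  have e11 : (starRingEnd ℂ) (M 1 1) = M 0 0 := by rw [← e00]; simp
  have v0 := congrFun hA 0
  have v1 := congrFun hA 1
  simp [Matrix.mulVec, dotProduct, Fin.sum_univ_two] at v0 v1
  have w0 := congrArg (starRingEnd ℂ) v0
  have w1 := congrArg (starRingEnd ℂ) v1
  simp only [map_add, map_mul, e00, e01, e10, e11] at w0 w1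
  ext i j
  fin_cases i <;> fin_cases j <;>
    simp [Matrix.mul_apply, Fin.sum_univ_two, Matrix.diagonal]
  · linear_combination v0
  · linear_combination -w1
  · linear_combination v1
  · linear_combination w0

/-- Two elements of `SU(2)` with a common eigenvector commute. -/
theorem su2_common_eigenvector_commute
    (A B : Matrix.specialUnitaryGroup (Fin 2) ℂ)
    (v : Fin 2 → ℂ) (hv : v ≠ 0) (a b : ℂ)
    (hA : A.val.mulVec v = a • v) (hB : B.val.mulVec v = b • v) :
    A * B = B * A := by
  have h1 := su2_aux A v a hA
  have h2 := su2_aux B v b hB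
  have hdet : IsUnit (!![v 0, -star (v 1); v 1, star (v 0)] : Matrix (Fin 2) (Fin 2) ℂ) := by
    rw [Matrix.isUnit_iff_isUnit_det, isUnit_iff_ne_zero, Matrix.det_fin_two_of]
    intro h
    apply hv
    have h3 : Complex.normSq (v 0) + Complex.normSq (v 1) = 0 := by
      have : ((Complex.normSq (v 0) + Complex.normSq (v 1) : ℝ) : ℂ) = 0 := by
        push_cast
        rw [← Complex.mul_conj, ← Complex.mul_conj]
        simp only [Complex.star_def] at h
        linear_combination h
      exact_mod_cast this
    have p0 := Complex.normSq_nonneg (v 0)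
    have p1 := Complex.normSq_nonneg (v 1)
    ext i
    fin_cases i
    · exact (Complex.normSq_eq_zero (z := v 0)).1 (by linarith)
    · exact (Complex.normSq_eq_zero (z := v 1)).1 (by linarith)
  apply Subtype.ext
  change A.val * B.val = B.val * A.val
  apply hdet.mul_right_cancel
  rw [mul_assoc, h2, ← mul_assoc, h1, mul_assoc B.val, h1, ← mul_assoc B.val, h2, mul_assoc,
    mul_assoc, Matrix.diagonal_mul_diagonal, Matrix.diagonal_mul_diagonal]
  congr 2
  ext i
  exact mul_comm _ _
end

section
/- Let α, β, α', β' ∈ ℝ and suppose there exists U ∈ SU(2) with U.val * D(α) * U.val⁻¹ = D(α') and U.val * D(β) * U.val⁻¹ = D(β'). Then either both α' − α and β' − β lie in 2π·ℤ, or both α' + α and β' + β lie in 2π·ℤ. (This is the statement that the pair of holonomy angles of a representation of ℤ² into SU(2) is well defined up to simultaneous sign change and shifts by 2π.) -/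
/-- The diagonal matrix with entries `exp (θ i)` and `exp (-θ i)`. -/
noncomputable def Dmat (θ : ℝ) : Matrix (Fin 2) (Fin 2) ℂ :=
  Matrix.diagonal ![Complex.exp ((θ : ℂ) * Complex.I), Complex.exp (-(θ : ℂ) * Complex.I)]

lemma aux_exp (a b : ℝ) (h : Complex.exp ((a : ℂ) * Complex.I) = Complex.exp ((b : ℂ) * Complex.I)) :
    ∃ m : ℤ, a - b = 2 * Real.pi * m := by
  obtain ⟨n, hn⟩ := Complex.exp_eq_exp_iff_exists_int.1 h
  refine ⟨n, ?_⟩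
  have := congrArg Complex.im hn
  simp at this
  linarith

lemma aux_conj (V : Matrix (Fin 2) (Fin 2) ℂ) (hV : V.det = 1) (a a' : ℝ)
    (h : V * Dmat a * V⁻¹ = Dmat a') :
    (V 0 0 ≠ 0 → ∃ m : ℤ, a' - a = 2 * Real.pi * m) ∧
    (V 0 1 ≠ 0 → ∃ m : ℤ, a' + a = 2 * Real.pi * m) := by
  have hu : IsUnit V.det := by simp [hV]
  have h2 : V * Dmat a = Dmat a' * V := by
    rw [← h, Matrix.nonsing_inv_mul_cancel_right _ _ hu]
  constructor
  · intro h0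
    have h3 := congrFun (congrFun h2 0) 0
    simp only [Dmat, Matrix.mul_diagonal, Matrix.diagonal_mul, Matrix.cons_val_zero] at h3
    rw [mul_comm] at h3
    exact aux_exp _ _ (mul_right_cancel₀ h0 h3).symm
  · intro h0
    have h3 := congrFun (congrFun h2 0) 1
    simp only [Dmat, Matrix.mul_diagonal, Matrix.diagonal_mul, Matrix.cons_val_zero,
      Matrix.cons_val_one] at h3
    rw [mul_comm] at h3
    obtain ⟨m, hm⟩ := aux_exp a' (-a) (by
      push_cast
      exact (mul_right_cancel₀ h0 h3).symm)
    exact ⟨m, by linarith⟩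

/-- The pair of holonomy angles of a representation of `ℤ²` into `SU(2)` is well defined up to
simultaneous sign change and shifts by `2π`. -/
theorem su2_pillowcase_coordinates_well_defined (α β α' β' : ℝ)
    (h : ∃ U : Matrix.specialUnitaryGroup (Fin 2) ℂ,
      U.val * Dmat α * U.val⁻¹ = Dmat α' ∧ U.val * Dmat β * U.val⁻¹ = Dmat β') :
    ((∃ m : ℤ, α' - α = 2 * Real.pi * m) ∧ (∃ n : ℤ, β' - β = 2 * Real.pi * n)) ∨
    ((∃ m : ℤ, α' + α = 2 * Real.pi * m) ∧ (∃ n : ℤ, β' + β = 2 * Real.pi * n)) := by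
  obtain ⟨U, h1, h2⟩ := h
  have hd : U.val.det = 1 := (Matrix.mem_specialUnitaryGroup_iff.1 U.2).2
  have A := aux_conj _ hd _ _ h1
  have B := aux_conj _ hd _ _ h2
  by_cases h0 : U.val 0 0 = 0
  · have h01 : U.val 0 1 ≠ 0 := by
      intro h01
      rw [Matrix.det_fin_two, h0, h01] at hd
      simp at hd
    exact Or.inr ⟨A.2 h01, B.2 h01⟩
  · exact Or.inl ⟨A.1 h0, B.1 h0⟩
end

section
/- Every nontrivial finitely generated commutative group G admits a non-trivial group homomorphism to SU(2): there exist ρ : G →* SU(2) and g ∈ G with ρ g ≠ 1. -/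
theorem aux_char (A : Type*) [AddCommGroup A] (a : A) (ha : a ≠ 0) :
    ∃ f : A →+ Additive Circle, f a ≠ 0 := by
  obtain ⟨c, hc⟩ : ∃ c : CharacterModule A, c a ≠ 0 := by
    by_contra! h
    exact ha (CharacterModule.eq_zero_of_character_apply h)
  let e : ℚ →+ Additive Circle :=
    { toFun := fun q => Additive.ofMul (Circle.exp (2 * Real.pi * (q : ℝ)))
      map_zero' := by simp
      map_add' := by
        intro x y
        rw [← ofMul_mul, ← Circle.exp_add]
        push_cast
        rw [mul_add] }
  have he : ∀ q : ℚ, e q = 0 ↔ q ∈ AddSubgroup.zmultiples (1 : ℚ) := by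
    intro q
    change Circle.exp (2 * Real.pi * (q : ℝ)) = 1 ↔ _
    rw [Circle.exp_eq_one, AddSubgroup.mem_zmultiples_iff]
    refine exists_congr fun n => ?_
    have hpi : (2 * Real.pi) ≠ 0 := by positivity
    rw [mul_comm (n : ℝ), mul_right_inj' hpi, zsmul_one]
    constructor
    · intro h
      exact_mod_cast h.symm
    · intro h
      rw [← h]; simp
  let E : AddCircle (1 : ℚ) →+ Additive Circle :=
    QuotientAddGroup.lift (AddSubgroup.zmultiples (1 : ℚ)) e (fun q hq => (he q).2 hq)
  have hE : ∀ x, E x = 0 → x = 0 := by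
    intro x
    induction x using QuotientAddGroup.induction_on with
    | H q =>
      intro h
      exact (QuotientAddGroup.eq_zero_iff q).2 ((he q).1 h)
  exact ⟨E.comp c, fun h => hc (hE _ h)⟩

noncomputable def diagSU : Circle →* Matrix.specialUnitaryGroup (Fin 2) ℂ where
  toFun z := ⟨!![(z : ℂ), 0; 0, ((z⁻¹ : Circle) : ℂ)], by
    rw [Matrix.mem_specialUnitaryGroup_iff, Matrix.mem_unitaryGroup_iff]
    constructor
    · have h : (z : ℂ) * (starRingEnd ℂ) z = 1 := by
        rw [← Circle.coe_inv_eq_conj, ← Circle.coe_mul]; simp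
      ext i j
      fin_cases i <;> fin_cases j <;>
        simp [Matrix.mul_apply, Matrix.star_apply, Fin.sum_univ_two, ← Circle.coe_inv_eq_conj]
    · simp [Matrix.det_fin_two]⟩
  map_one' := by
    apply Subtype.ext
    ext i j
    fin_cases i <;> fin_cases j <;> simp
  map_mul' x y := by
    apply Subtype.ext
    ext i j
    fin_cases i <;> fin_cases j <;> simp [Matrix.mul_apply, Fin.sum_univ_two, mul_comm]

/-- Every nontrivial finitely generated commutative group admits a non-trivial homomorphism
to `SU(2)`. -/
theorem nontrivial_fg_comm_group_has_nontrivial_su2_rep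
    (G : Type*) [CommGroup G] [Group.FG G] [Nontrivial G] :
    ∃ ρ : G →* Matrix.specialUnitaryGroup (Fin 2) ℂ, ∃ g : G, ρ g ≠ 1 := by
  obtain ⟨g, hg⟩ := exists_ne (1 : G)
  obtain ⟨f, hf⟩ := aux_char (Additive G) (Additive.ofMul g) (fun h => hg h)
  let f' : G →* Circle := MonoidHom.toAdditive.symm f
  refine ⟨diagSU.comp f', g, fun h => hf ?_⟩
  have h1 := congrArg (fun M => M.1 0 0) h
  have h2 : ((f' g : Circle) : ℂ) = 1 := by simpa [diagSU] using h1
  have h3 : f' g = 1 := Circle.ext (by simpa using h2)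
  exact h3
end

section
/- Two loops on the torus with homologically independent classes must intersect: let a, b, c, d ∈ ℤ with a*d − b*c ≠ 0, and let f, g : ℝ → ℝ × ℝ be continuous maps satisfying f (t + 1) = f t + (a, b) and g (t + 1) = g t + (c, d) for all t ∈ ℝ. Then there exist s, t ∈ ℝ and m, n ∈ ℤ with f s = g t + (m, n). (This is the intersection statement used for the images of the two knot exteriors in the pillowcase of the splicing torus.) -/
theorem core_zero (G : ℂ → ℂ) (hG : Continuous G) (M : ℝ) (hM : ∀ z, ‖G z - z‖ ≤ M) :
    ∃ z, G z = 0 := by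
  by_contra! hne
  have hM0 : 0 ≤ M := (norm_nonneg _).trans (hM 0)
  obtain ⟨L, ⟨-, hL⟩, -⟩ := Complex.isCoveringMapOn_exp.existsUnique_continuousMap_lifts
    (A := ℂ) ⟨G, hG⟩ (a₀ := 0) (e₀ := Complex.log (G 0)) (Complex.exp_log (hne 0))
    (fun z => hne z)
  have hL' : ∀ z, Complex.exp (L z) = G z := fun z => congrFun hL z
  set R : ℂ := ((M + 1 : ℝ) : ℂ) with hR
  have hR0 : R ≠ 0 := by
    rw [hR]; exact_mod_cast (by positivity : M + 1 ≠ 0)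
  have hRn : ‖R‖ = M + 1 := by
    rw [hR, Complex.norm_real, Real.norm_of_nonneg (by positivity)]
  let z : ℝ → ℂ := fun θ => R * Complex.exp (θ * Complex.I)
  have hz0 : ∀ θ, z θ ≠ 0 := fun θ => mul_ne_zero hR0 (Complex.exp_ne_zero _)
  have hzn : ∀ θ, ‖z θ‖ = M + 1 := fun θ => by
    simp [z, hRn, Complex.norm_exp_ofReal_mul_I]
  have hzc : Continuous z := by fun_prop
  let w : ℝ → ℂ := fun θ => G (z θ) / z θ
  have hwc : Continuous w := (hG.comp hzc).div hzc hz0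
  have hw0 : ∀ θ, w θ ≠ 0 := fun θ => div_ne_zero (hne _) (hz0 _)
  have hws : ∀ θ, w θ ∈ Complex.slitPlane := fun θ => by
    have h1 : ‖w θ - 1‖ < 1 := by
      have : w θ - 1 = (G (z θ) - z θ) / z θ := by
        simp only [w]; field_simp [hz0 θ]
      rw [this, norm_div, hzn, div_lt_one (by positivity)]
      linarith [hM (z θ)]
    have := Complex.mem_slitPlane_of_norm_lt_one h1
    simpa using this
  let u : ℝ → ℂ := fun θ => L (z θ) - Complex.log (w θ) - θ * Complex.I
  have hlog : Continuous fun θ => Complex.log (w θ) := hwc.clog hws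
  have hu : Continuous u := by fun_prop
  have hexp : ∀ θ, Complex.exp (u θ) = R := fun θ => by
    simp only [u]
    rw [Complex.exp_sub, Complex.exp_sub, hL', Complex.exp_log (hw0 θ)]
    have h1 := hz0 θ
    have h2 := hne (z θ)
    simp only [w]
    rw [div_div_cancel₀ h2]
    simp [z]
  have hconst : u = fun _ => u 0 := by
    refine Complex.isCoveringMap_exp.eq_of_comp_eq hu continuous_const ?_ 0 rfl
    funext θ
    simp [hexp]
  have h2 := congrFun hconst (2 * Real.pi)
  have hzz : z (2 * Real.pi) = z 0 := by simp [z, Complex.exp_two_pi_mul_I]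
  have hww : w (2 * Real.pi) = w 0 := by simp only [w, hzz]
  simp [u, hzz, hww] at h2

theorem bdd_aux (a b : ℤ) (f : ℝ → ℝ × ℝ) (hf : Continuous f)
    (hf1 : ∀ t : ℝ, f (t + 1) = f t + ((a : ℝ), (b : ℝ))) :
    ∃ K, ∀ t, |(f t).1 - a * t| ≤ K ∧ |(f t).2 - b * t| ≤ K := by
  let p : ℝ → ℝ × ℝ := fun t => ((f t).1 - a * t, (f t).2 - b * t)
  have hp : Function.Periodic p 1 := fun t => by
    simp only [p, hf1, Prod.fst_add, Prod.snd_add]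
    ext <;> simp <;> ring
  have hpc : Continuous p := by fun_prop
  obtain ⟨K, hK⟩ := (hp.compact_of_continuous one_ne_zero hpc).isBounded.exists_norm_le
  refine ⟨K, fun t => ?_⟩
  have := hK (p t) ⟨t, rfl⟩
  rw [Prod.norm_def, max_le_iff] at this
  exact this

/-- Two loops on the torus `ℝ²/ℤ²` whose homology classes `(a, b)` and `(c, d)` are linearly
independent must intersect. -/
theorem torus_loops_independent_classes_intersect
    (a b c d : ℤ) (h : a * d - b * c ≠ 0)
    (f g : ℝ → ℝ × ℝ) (hf : Continuous f) (hg : Continuous g)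
    (hf1 : ∀ t : ℝ, f (t + 1) = f t + ((a : ℝ), (b : ℝ)))
    (hg1 : ∀ t : ℝ, g (t + 1) = g t + ((c : ℝ), (d : ℝ))) :
    ∃ s t : ℝ, ∃ m n : ℤ, f s = g t + ((m : ℝ), (n : ℝ)) := by
  obtain ⟨K, hK⟩ := bdd_aux a b f hf hf1
  obtain ⟨N, hN⟩ := bdd_aux c d g hg hg1
  have hD : (a * d - b * c : ℝ) ≠ 0 := by exact_mod_cast h
  let S : ℂ → ℝ := fun z => (d * z.re - c * z.im) / (a * d - b * c)
  let T : ℂ → ℝ := fun z => (b * z.re - a * z.im) / (a * d - b * c)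
  have hS : Continuous S := by fun_prop
  have hT : Continuous T := by fun_prop
  have e1 : ∀ z, a * S z - c * T z = z.re := fun z => by
    simp only [S, T]; rw [← mul_div_assoc, ← mul_div_assoc, ← sub_div, div_eq_iff hD]; ring
  have e2 : ∀ z, b * S z - d * T z = z.im := fun z => by
    simp only [S, T]; rw [← mul_div_assoc, ← mul_div_assoc, ← sub_div, div_eq_iff hD]; ring
  let G : ℂ → ℂ := fun z => (((f (S z)).1 - (g (T z)).1 : ℝ) : ℂ) +
    (((f (S z)).2 - (g (T z)).2 : ℝ) : ℂ) * Complex.I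
  have hG : Continuous G := by fun_prop
  obtain ⟨z, hz⟩ := core_zero G hG ((K + N) + (K + N)) (fun z => by
    refine (Complex.norm_le_abs_re_add_abs_im _).trans ?_
    obtain ⟨h1, h2⟩ := hK (S z)
    obtain ⟨h3, h4⟩ := hN (T z)
    have r1 : (G z - z).re = (f (S z)).1 - (g (T z)).1 - z.re := by simp [G]
    have r2 : (G z - z).im = (f (S z)).2 - (g (T z)).2 - z.im := by simp [G]
    rw [r1, r2, ← e1 z, ← e2 z]
    rw [abs_le] at h1 h2 h3 h4
    refine add_le_add ?_ ?_ <;> rw [abs_le] <;> constructor <;> linarith)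
  refine ⟨S z, T z, 0, 0, ?_⟩
  have r1 : (G z).re = (f (S z)).1 - (g (T z)).1 := by simp [G]
  have r2 : (G z).im = (f (S z)).2 - (g (T z)).2 := by simp [G]
  rw [hz] at r1 r2
  simp only [Complex.zero_re, Complex.zero_im] at r1 r2
  ext
  · simp; linarith
  · simp; linarith
end
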